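/- arXiv:1507.01505 — 3 statements merged into one kernel-verified Lean document; each statement's English description precedes it below -/
import Mathlib

section
/- Let W be a 2π-periodic weight function and let n and N be positive integers such that 2N > (∫_{-π}^{π} W(θ)dθ) · sup_{p ∈ T_n^+} (∫_{-π}^{π} |p'(θ)|dθ) / (∫_{-π}^{π} p(θ)W(θ)dθ). Then there exists a finite set S ⊂ [-π, π) such that every trigonometric polynomial q of degree at most n which is not identically zero and satisfies ∫_{-π}^{π} q(θ)W(θ)dθ = 0 also satisfies 2N·max_{x ∈ S} q(x) > ∫_{-π}^{π} |q'(θ)|dθ. -/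
open MeasureTheory Real Set

noncomputable section

/-- A trigonometric polynomial of degree at most `n`. -/
def IsTrigPoly (n : ℕ) (p : ℝ → ℝ) : Prop :=
  ∃ a b : ℕ → ℝ, ∀ θ : ℝ,
    p θ = a 0 + ∑ k ∈ Finset.Icc 1 n, (a k * Real.cos (k * θ) + b k * Real.sin (k * θ))

/-- A `2π`-periodic weight function. -/
def IsPeriodicWeight (W : ℝ → ℝ) : Prop :=
  Measurable W ∧ (∀ θ, 0 ≤ W θ) ∧ Function.Periodic W (2 * π) ∧
  IntervalIntegrable W volume (-π) π ∧ 0 < ∫ θ in (-π)..π, W θ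

/-- The trigonometric polynomials of degree at most `n`, as a subspace of the functions on `ℝ`. -/
def trigPolySubmodule (n : ℕ) : Submodule ℝ (ℝ → ℝ) where
  carrier := {p | IsTrigPoly n p}
  zero_mem' := ⟨0, 0, by simp⟩
  add_mem' := by
    rintro p q ⟨a, b, hp⟩ ⟨c, d, hq⟩
    refine ⟨a + c, b + d, fun θ => ?_⟩
    have h : ∀ k : ℕ, (a + c) k * Real.cos (k * θ) + (b + d) k * Real.sin (k * θ)
        = (a k * Real.cos (k * θ) + b k * Real.sin (k * θ))
          + (c k * Real.cos (k * θ) + d k * Real.sin (k * θ)) := fun k => by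
      simp only [Pi.add_apply]; ring
    simp only [h, Finset.sum_add_distrib]
    simp only [Pi.add_apply, hp θ, hq θ, Finset.sum_add_distrib]
    ring
  smul_mem' := by
    rintro r p ⟨a, b, hp⟩
    refine ⟨r • a, r • b, fun θ => ?_⟩
    simp only [Pi.smul_apply, smul_eq_mul, hp θ, mul_add, Finset.mul_sum, mul_assoc]

instance finiteDimensional_trigPolySubmodule (n : ℕ) :
    FiniteDimensional ℝ (trigPolySubmodule n) := by
  classical
  let B : Set (ℝ → ℝ) := (fun k : ℕ => fun θ : ℝ => Real.cos (k * θ)) '' Finset.Icc 0 n ∪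
    (fun k : ℕ => fun θ : ℝ => Real.sin (k * θ)) '' Finset.Icc 0 n
  have hB : B.Finite :=
    ((Finset.finite_toSet _).image _).union ((Finset.finite_toSet _).image _)
  have := FiniteDimensional.span_of_finite ℝ hB
  refine Submodule.finiteDimensional_of_le (S₂ := Submodule.span ℝ B) ?_
  rintro p ⟨a, b, hp⟩
  have hc : ∀ k ≤ n, (fun θ : ℝ => Real.cos (k * θ)) ∈ Submodule.span ℝ B := fun k hk =>
    Submodule.subset_span (Or.inl ⟨k, by simpa using hk, rfl⟩)
  have hs : ∀ k ≤ n, (fun θ : ℝ => Real.sin (k * θ)) ∈ Submodule.span ℝ B := fun k hk =>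
    Submodule.subset_span (Or.inr ⟨k, by simpa using hk, rfl⟩)
  have hpe : p = a 0 • (fun θ : ℝ => Real.cos ((0 : ℕ) * θ)) + ∑ k ∈ Finset.Icc 1 n,
      (a k • (fun θ : ℝ => Real.cos (k * θ)) + b k • (fun θ : ℝ => Real.sin (k * θ))) := by
    ext θ
    simp [hp θ, Finset.sum_apply]
  rw [hpe]
  refine add_mem (Submodule.smul_mem _ _ (hc 0 n.zero_le)) (sum_mem fun k hk => ?_)
  have hk' := (Finset.mem_Icc.1 hk).2
  exact add_mem (Submodule.smul_mem _ _ (hc k hk')) (Submodule.smul_mem _ _ (hs k hk'))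

namespace IsTrigPoly

variable {n : ℕ} {p : ℝ → ℝ}

theorem analyticOnNhd (hp : IsTrigPoly n p) : AnalyticOnNhd ℝ p univ := by
  obtain ⟨a, b, hp⟩ := hp
  rw [funext hp]
  intro x _
  refine analyticAt_const.add (Finset.analyticAt_fun_sum _ fun k _ => ?_)
  fun_prop

theorem contDiff (hp : IsTrigPoly n p) : ContDiff ℝ 1 p := by
  obtain ⟨a, b, hp⟩ := hp
  rw [funext hp]
  fun_prop

theorem periodic (hp : IsTrigPoly n p) : Function.Periodic p (2 * π) := by
  obtain ⟨a, b, hp⟩ := hp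
  intro θ
  rw [hp, hp]
  congr 1
  refine Finset.sum_congr rfl fun k _ => ?_
  rw [mul_add, Real.cos_add_nat_mul_two_pi, Real.sin_add_nat_mul_two_pi]

theorem const_sub (hp : IsTrigPoly n p) (M : ℝ) : IsTrigPoly n (fun θ => M - p θ) :=
  (trigPolySubmodule n).sub_mem (x := fun _ => M) (show IsTrigPoly n _ from
    ⟨fun k => if k = 0 then M else 0, 0, fun θ => by
      rw [Finset.sum_eq_zero fun k hk => by
        have := (Finset.mem_Icc.1 hk).1
        simp [show k ≠ 0 by omega]]
      simp⟩) hp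

theorem ae_ne_zero (hp : IsTrigPoly n p) (h : p ≠ 0) : ∀ᵐ θ, p θ ≠ 0 := by
  obtain ⟨x, hx⟩ := Function.ne_iff.1 h
  have := hp.analyticOnNhd.preimage_zero_mem_codiscrete hx
  have h' := ae_restrict_le_codiscreteWithin (μ := volume) MeasurableSet.univ this
  rw [Measure.restrict_univ] at h'
  exact h'

theorem exists_isMax (hp : IsTrigPoly n p) : ∃ x ∈ Ico (-π) π, ∀ θ, p θ ≤ p x := by
  have hπ : (0 : ℝ) < 2 * π := by positivity
  obtain ⟨y, -, hy⟩ := isCompact_Icc.exists_isMaxOn (s := Icc (-π) π)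
    (nonempty_Icc.2 (by linarith)) hp.contDiff.continuous.continuousOn
  have key : ∀ z, ∃ w ∈ Ico (-π) π, p z = p w := fun z => by
    simpa [two_mul] using hp.periodic.exists_mem_Ico hπ z (-π)
  obtain ⟨x, hx, hxy⟩ := key y
  refine ⟨x, hx, fun θ => ?_⟩
  obtain ⟨w, hw, hθ⟩ := key θ
  rw [hθ, ← hxy]
  exact hy (Ico_subset_Icc_self hw)

theorem intervalIntegrable_mul (hp : IsTrigPoly n p) {W : ℝ → ℝ} (hW : IsPeriodicWeight W) :
    IntervalIntegrable (fun θ => p θ * W θ) volume (-π) π :=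
  hW.2.2.2.1.continuousOn_mul hp.contDiff.continuous.continuousOn

theorem integral_mul_pos (hp : IsTrigPoly n p) {W : ℝ → ℝ} (hW : IsPeriodicWeight W)
    (h0 : ∀ θ, 0 ≤ p θ) (h : p ≠ 0) : 0 < ∫ θ in (-π)..π, p θ * W θ := by
  have hπ : -π < π := by linarith [Real.pi_pos]
  rw [intervalIntegral.integral_pos_iff_support_of_nonneg_ae
    (ae_of_all _ fun θ => mul_nonneg (h0 θ) (hW.2.1 θ)) (hp.intervalIntegrable_mul hW)]
  have hpos := hW.2.2.2.2
  rw [intervalIntegral.integral_pos_iff_support_of_nonneg_ae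
    (ae_of_all _ hW.2.1) hW.2.2.2.1] at hpos
  refine ⟨hπ, hpos.2.trans_le (measure_mono_ae ?_)⟩
  filter_upwards [hp.ae_ne_zero h] with θ hθ hθW
  exact ⟨mul_ne_zero hθ hθW.1, hθW.2⟩

/-- A nonzero trigonometric polynomial of weighted mean zero satisfies the variation bound at one
of its maximum points. -/
theorem exists_integral_abs_deriv_lt {N : ℕ} {W : ℝ → ℝ} (hW : IsPeriodicWeight W)
    {S : ℝ}
    (hS : ∀ p : ℝ → ℝ, IsTrigPoly n p → (∀ θ, 0 ≤ p θ) → p ≠ 0 →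
      (∫ θ in (-π)..π, |deriv p θ|) / (∫ θ in (-π)..π, p θ * W θ) ≤ S)
    (hSN : (∫ θ in (-π)..π, W θ) * S < 2 * N)
    (hp : IsTrigPoly n p) (h : p ≠ 0) (hmean : (∫ θ in (-π)..π, p θ * W θ) = 0) :
    ∃ x ∈ Ico (-π) π, (∫ θ in (-π)..π, |deriv p θ|) < 2 * N * p x := by
  obtain ⟨x, hx, hmax⟩ := hp.exists_isMax
  refine ⟨x, hx, ?_⟩
  have hWpos := hW.2.2.2.2
  set M := p x
  have hr := hp.const_sub M
  have hr0 : ∀ θ, 0 ≤ M - p θ := fun θ => sub_nonneg.2 (hmax θ)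
  have hint : (∫ θ in (-π)..π, (M - p θ) * W θ) = M * ∫ θ in (-π)..π, W θ := by
    simp only [sub_mul]
    rw [intervalIntegral.integral_sub (hW.2.2.2.1.const_mul M) (hp.intervalIntegrable_mul hW),
      hmean, intervalIntegral.integral_const_mul, sub_zero]
  have hne : (fun θ => M - p θ) ≠ 0 := by
    intro h0
    have hpc : ∀ θ, p θ = M := fun θ => (sub_eq_zero.1 (congrFun h0 θ)).symm
    simp only [hpc, intervalIntegral.integral_const_mul] at hmean
    have hM : M = 0 := (mul_eq_zero.1 hmean).resolve_right hWpos.ne'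
    exact h (funext fun θ => by simp [hpc θ, hM])
  have hMW : 0 < M * ∫ θ in (-π)..π, W θ := hint ▸ hr.integral_mul_pos hW hr0 hne
  have hM : 0 < M := pos_of_mul_pos_left hMW hWpos.le
  have hb := hS _ hr hr0 hne
  rw [hint, div_le_iff₀ hMW] at hb
  simp only [deriv_const_sub, abs_neg] at hb
  calc _ ≤ _ := hb
    _ = ((∫ θ in (-π)..π, W θ) * S) * M := by ring
    _ < _ := mul_lt_mul_of_pos_right hSN hM

end IsTrigPoly

/-- Kane's analysis lemma: if `2N > (∫ W) · sup_{p ∈ T_n^+} (∫|p'|)/(∫ p W)` (expressed by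
the existence of an upper bound `S` of the ratios with `(∫ W)·S < 2N`), then there is a finite
set `S₀ ⊂ [-π, π)` such that every non-zero `q ∈ T_n` with `∫ q W = 0` satisfies
`2N · max_{x ∈ S₀} q(x) > ∫ |q'|`. -/
theorem kane_analysis_lemma (W : ℝ → ℝ) (hW : IsPeriodicWeight W)
    (n N : ℕ) (hn : 1 ≤ n) (hN : 1 ≤ N)
    (hsup : ∃ S : ℝ,
      (∀ p : ℝ → ℝ, IsTrigPoly n p → (∀ θ, 0 ≤ p θ) → p ≠ 0 →
        (∫ θ in (-π)..π, |deriv p θ|) / (∫ θ in (-π)..π, p θ * W θ) ≤ S) ∧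
      (∫ θ in (-π)..π, W θ) * S < 2 * N) :
    ∃ S₀ : Finset ℝ, (↑S₀ : Set ℝ) ⊆ Ico (-π) π ∧
      ∀ q : ℝ → ℝ, IsTrigPoly n q → q ≠ 0 → (∫ θ in (-π)..π, q θ * W θ) = 0 →
        ∃ x ∈ S₀, (∫ θ in (-π)..π, |deriv q θ|) < 2 * N * q x := by
  obtain ⟨S, hS, hSN⟩ := hsup
  let e := Module.finBasis ℝ (trigPolySubmodule n)
  let φ : Fin (Module.finrank ℝ (trigPolySubmodule n)) → ℝ → ℝ := fun i => e i
  have hφ : ∀ i, IsTrigPoly n (φ i) := fun i => (e i).2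
  let Q : (Fin (Module.finrank ℝ (trigPolySubmodule n)) → ℝ) → ℝ → ℝ :=
    fun c => ((e.equivFun.symm c : trigPolySubmodule n) : ℝ → ℝ)
  have hQ : ∀ c, IsTrigPoly n (Q c) := fun c => (e.equivFun.symm c).2
  have hQapp : ∀ c, Q c = fun θ => ∑ i, c i * φ i θ := fun c => by
    ext θ
    simp [Q, φ, Module.Basis.equivFun_symm_apply, Finset.sum_apply]
  have hQne : ∀ c ≠ 0, Q c ≠ 0 := fun c hc h0 =>
    hc (e.equivFun.symm.map_eq_zero_iff.1 (Subtype.ext h0))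
  have hderiv : ∀ c, deriv (Q c) = fun θ => ∑ i, c i * deriv (φ i) θ := fun c => by
    ext θ
    rw [hQapp, deriv_fun_sum fun i _ =>
      (((hφ i).contDiff.differentiable one_ne_zero).differentiableAt).const_mul _]
    simp
  have hvar : Continuous fun c => ∫ θ in (-π)..π, |deriv (Q c) θ| := by
    simp only [hderiv]
    refine intervalIntegral.continuous_parametric_intervalIntegral_of_continuous' ?_ _ _
    have := fun i => (hφ i).contDiff.continuous_deriv le_rfl
    simp only [Function.uncurry_def]
    fun_prop
  have heval : ∀ x, Continuous fun c => Q c x := fun x => by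
    simp only [hQapp]
    fun_prop
  have hmean : Continuous fun c => ∫ θ in (-π)..π, Q c θ * W θ := by
    have : ∀ c, (∫ θ in (-π)..π, Q c θ * W θ) = ∑ i, c i * ∫ θ in (-π)..π, φ i θ * W θ := by
      intro c
      simp only [hQapp, Finset.sum_mul, mul_assoc]
      rw [intervalIntegral.integral_finsetSum fun i _ =>
        ((hφ i).intervalIntegrable_mul hW).const_mul _]
      simp only [intervalIntegral.integral_const_mul]
    simp only [this]
    fun_prop
  have hK := (isCompact_sphere (0 : Fin (Module.finrank ℝ (trigPolySubmodule n)) → ℝ) 1).inter_right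
    (isClosed_eq hmean continuous_const : IsClosed {c | (∫ θ in (-π)..π, Q c θ * W θ) = 0})
  obtain ⟨T, hT, hTfin, hcover⟩ := hK.elim_finite_subcover_image (b := Ico (-π) π)
    (c := fun x => {c | (∫ θ in (-π)..π, |deriv (Q c) θ|) < 2 * N * Q c x})
    (fun x _ => isOpen_lt hvar ((heval x).const_mul _)) (by
      rintro c ⟨hc, hc0⟩
      have hcne : c ≠ 0 := ne_zero_of_mem_unit_sphere (⟨c, hc⟩ : Metric.sphere _ _)
      simpa using (hQ c).exists_integral_abs_deriv_lt hW hS hSN (hQne c hcne) hc0)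
  refine ⟨hTfin.toFinset, by simpa using hT, fun q hq hq0 hqW => ?_⟩
  set c := e.equivFun ⟨q, hq⟩ with hc
  have hcne : c ≠ 0 := fun h0 =>
    hq0 (congrArg Subtype.val (e.equivFun.map_eq_zero_iff.1 h0))
  have hr : 0 < ‖c‖⁻¹ := inv_pos.2 (norm_pos_iff.2 hcne)
  have hQc : Q (‖c‖⁻¹ • c) = fun θ => ‖c‖⁻¹ * q θ := by
    simp only [Q, hc, map_smul, LinearEquiv.symm_apply_apply]
    rfl
  have hmem := @hcover (‖c‖⁻¹ • c) ⟨by simp [norm_smul, hcne], by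
    simp only [mem_ofPred_eq, hQc, mul_assoc, intervalIntegral.integral_const_mul, hqW, mul_zero]⟩
  simp only [mem_iUnion, mem_ofPred_eq, exists_prop] at hmem
  obtain ⟨x, hx, hlt⟩ := hmem
  refine ⟨x, by simpa using hx, ?_⟩
  simp only [hQc, deriv_const_mul_field, abs_mul, abs_of_pos hr,
    intervalIntegral.integral_const_mul] at hlt
  refine lt_of_mul_lt_mul_left (a := ‖c‖⁻¹) ?_ hr.le
  linarith
end
end

section
/- Let v_1, v_2, …, v_R be points in ℝ^n, no n+1 of which lie on a common affine hyperplane, and let Q ⊂ ℝ^n be their convex hull. Let -π ≤ x_1 < x_2 < … < x_R < π and let N be a positive integer. Then there exist continuous functions f_1, f_2, …, f_N from Q to [-π, π) with the following property: whenever u ∈ ℝ^n, u ≠ 0, and b ∈ ℝ satisfy u·w ≤ b for all w ∈ Q, and 1 ≤ i_1 < i_2 < … < i_n ≤ R are indices with u·v_{i_k} = b for all k, then for every v in the convex hull of {v_{i_1}, …, v_{i_n}}: all of f_1(v), …, f_N(v) lie in [x_{i_1}, x_{i_n}], and each of the open intervals (x_{i_1}, x_{i_2}), (x_{i_2}, x_{i_3}),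 …, (x_{i_{n-1}}, x_{i_n}) contains at most one element of the multiset {f_1(v), …, f_N(v)}. -/
open Real Set Matrix

noncomputable section

/-- The truncated affine function `s ↦ min 1 (max 0 (N s - j))`, which increases from `0` to `1`
on the interval `[j / N, (j + 1) / N]`. -/
def ramp (N j : ℕ) (s : ℝ) : ℝ := min 1 (max 0 (N * s - j))

lemma continuous_ramp (N j : ℕ) : Continuous (ramp N j) := by
  unfold ramp; fun_prop

lemma ramp_mono (N j : ℕ) : Monotone (ramp N j) := by
  intro s t h
  unfold ramp
  gcongr

/-- The total mass that `a` gives to the indices smaller than `m`. -/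
def cumulative {R : ℕ} (a : Fin R → ℝ) (m : ℕ) : ℝ :=
  ∑ l : Fin R, if (l : ℕ) < m then a l else 0

lemma cumulative_mono {R : ℕ} {a : Fin R → ℝ} (ha : ∀ l, 0 ≤ a l) : Monotone (cumulative a) := by
  intro s t h
  refine Finset.sum_le_sum fun l _ => ?_
  split_ifs with h1 h2
  · exact le_rfl
  · omega
  · exact ha l
  · exact le_rfl

lemma cumulative_zero {R : ℕ} (a : Fin R → ℝ) : cumulative a 0 = 0 := by
  simp [cumulative]

lemma cumulative_self {R : ℕ} (a : Fin R → ℝ) : cumulative a R = ∑ l, a l := by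
  simp [cumulative]

lemma cumulative_succ_of_eq_zero {R : ℕ} {a : Fin R → ℝ} {l : Fin R} (hl : a l = 0) :
    cumulative a (l + 1) = cumulative a l := by
  refine Finset.sum_congr rfl fun m _ => ?_
  rcases eq_or_ne m l with rfl | h
  · simp [hl]
  · have : (m : ℕ) ≠ l := fun h' => h (Fin.ext h')
    have : (m : ℕ) < l + 1 ↔ (m : ℕ) < l := by omega
    simp [this]

lemma continuous_cumulative {R : ℕ} (m : ℕ) :
    Continuous fun a : Fin R → ℝ => cumulative a m := by
  unfold cumulative
  refine continuous_finsetSum _ fun l _ => ?_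
  split_ifs <;> fun_prop

/-- The fraction of the mass of `a` between the levels `j / N` and `(j + 1) / N` that sits
at the index `l`. -/
def sliceWeight (N j : ℕ) {R : ℕ} (a : Fin R → ℝ) (l : Fin R) : ℝ :=
  ramp N j (cumulative a (l + 1)) - ramp N j (cumulative a l)

section sliceWeight

variable {N j R : ℕ} {a : Fin R → ℝ}

lemma sliceWeight_nonneg (ha : ∀ l, 0 ≤ a l) (l : Fin R) : 0 ≤ sliceWeight N j a l :=
  sub_nonneg.2 (ramp_mono N j (cumulative_mono ha (Nat.le_succ _)))

lemma sliceWeight_eq_zero {l : Fin R} (hl : a l = 0) : sliceWeight N j a l = 0 := by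
  simp [sliceWeight, cumulative_succ_of_eq_zero hl]

lemma sum_sliceWeight (hj : j < N) (ha : ∑ l, a l = 1) : ∑ l, sliceWeight N j a l = 1 := by
  have h := Finset.sum_range (n := R) fun m =>
    ramp N j (cumulative a (m + 1)) - ramp N j (cumulative a m)
  rw [Finset.sum_range_sub fun m => ramp N j (cumulative a m), cumulative_self, ha,
    cumulative_zero] at h
  unfold sliceWeight
  rw [← h]
  have h1 : (j : ℝ) + 1 ≤ N := by exact_mod_cast hj
  have h2 : (1 : ℝ) ≤ N - j := by linarith
  simp [ramp, h2]

lemma cumulative_lt_of_sliceWeight_pos {l : Fin R} (h : 0 < sliceWeight N j a l) :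
    N * cumulative a l < j + 1 := by
  by_contra! hc
  have h1 : ramp N j (cumulative a l) = 1 := by
    unfold ramp
    exact min_eq_left (le_max_of_le_right (by linarith))
  have h2 : ramp N j (cumulative a (l + 1)) ≤ 1 := min_le_left _ _
  unfold sliceWeight at h
  linarith

lemma lt_cumulative_of_sliceWeight_pos {l : Fin R}
    (h : 0 < sliceWeight N j a l) : j < N * cumulative a (l + 1) := by
  by_contra! hc
  have h1 : ramp N j (cumulative a (l + 1)) = 0 := by
    unfold ramp
    rw [max_eq_left (by linarith)]
    simp
  have h2 : 0 ≤ ramp N j (cumulative a l) := le_min zero_le_one (le_max_left _ _)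
  unfold sliceWeight at h
  linarith

end sliceWeight

/-- The average of `x` over the mass of `a` between the levels `j / N` and `(j + 1) / N`. -/
def sliceMean {R : ℕ} (x : Fin R → ℝ) (N j : ℕ) (a : Fin R → ℝ) : ℝ :=
  ∑ l, sliceWeight N j a l * x l

section sliceMean

variable {R N j : ℕ} {x a : Fin R → ℝ}

lemma continuous_sliceMean (x : Fin R → ℝ) (N j : ℕ) : Continuous (sliceMean x N j) := by
  unfold sliceMean sliceWeight
  refine continuous_finsetSum _ fun l _ => ?_
  exact (((continuous_ramp N j).comp (continuous_cumulative _)).sub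
    ((continuous_ramp N j).comp (continuous_cumulative _))).mul continuous_const

lemma sliceMean_mem {s : Set ℝ} (hs : Convex ℝ s) (hj : j < N) (ha : a ∈ stdSimplex ℝ (Fin R))
    (hx : ∀ l, x l ∈ s) : sliceMean x N j a ∈ s :=
  hs.sum_mem (fun l _ => sliceWeight_nonneg ha.1 l) (sum_sliceWeight hj ha.2) fun l _ => hx l

lemma exists_lt_of_lt_sliceMean (hj : j < N) (ha : a ∈ stdSimplex ℝ (Fin R)) {c : ℝ}
    (h : c < sliceMean x N j a) : ∃ l, 0 < sliceWeight N j a l ∧ c < x l := by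
  by_contra! hc
  have : sliceMean x N j a ≤ ∑ l, sliceWeight N j a l * c := by
    refine Finset.sum_le_sum fun l _ => ?_
    rcases (sliceWeight_nonneg (N := N) (j := j) ha.1 l).eq_or_lt with h0 | h0
    · simp [← h0]
    · exact mul_le_mul_of_nonneg_left (hc l h0) h0.le
  rw [← Finset.sum_mul, sum_sliceWeight hj ha.2] at this
  linarith

lemma exists_gt_of_sliceMean_lt (hj : j < N) (ha : a ∈ stdSimplex ℝ (Fin R)) {c : ℝ}
    (h : sliceMean x N j a < c) : ∃ l, 0 < sliceWeight N j a l ∧ x l < c := by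
  have h' : -c < sliceMean (-x) N j a := by
    simp only [sliceMean, Pi.neg_apply, mul_neg, Finset.sum_neg_distrib] at h ⊢
    linarith
  obtain ⟨l, hl, hc⟩ := exists_lt_of_lt_sliceMean hj ha h'
  exact ⟨l, hl, neg_lt_neg_iff.1 hc⟩

end sliceMean

/-- The face of the standard simplex spanned by the vertices with index in the range of `i`. -/
def simplexFace {n R : ℕ} (i : Fin n → Fin R) : Set (Fin R → ℝ) :=
  {a | a ∈ stdSimplex ℝ (Fin R) ∧ ∀ l, l ∉ Set.range i → a l = 0}

section simplexFace

variable {n R N j : ℕ} {i : Fin n → Fin R} {x a : Fin R → ℝ}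

lemma isCompact_simplexFace (i : Fin n → Fin R) : IsCompact (simplexFace i) := by
  refine (isCompact_stdSimplex ℝ (Fin R)).inter_right (t := {a | ∀ l, l ∉ Set.range i → a l = 0}) ?_
  simp only [Set.ofPred_forall]
  exact isClosed_iInter fun l => isClosed_iInter fun _ =>
    isClosed_eq (continuous_apply l) continuous_const

lemma mem_range_of_sliceWeight_pos (ha : a ∈ simplexFace i) {l : Fin R}
    (h : 0 < sliceWeight N j a l) : ∃ k, i k = l := by
  by_contra hl
  rw [sliceWeight_eq_zero (ha.2 l hl)] at h
  exact h.false

lemma sliceMean_mem_Icc (hx : StrictMono x) (hi : StrictMono i) (hj : j < N)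
    (ha : a ∈ simplexFace i) {k₀ k₁ : Fin n} (h₀ : ∀ k, k₀ ≤ k) (h₁ : ∀ k, k ≤ k₁) :
    sliceMean x N j a ∈ Icc (x (i k₀)) (x (i k₁)) := by
  constructor
  · by_contra! h
    obtain ⟨l, hl, hlt⟩ := exists_gt_of_sliceMean_lt hj ha.1 h
    obtain ⟨k, rfl⟩ := mem_range_of_sliceWeight_pos ha hl
    exact hlt.not_ge (hx.monotone (hi.monotone (h₀ k)))
  · by_contra! h
    obtain ⟨l, hl, hlt⟩ := exists_lt_of_lt_sliceMean hj ha.1 h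
    obtain ⟨k, rfl⟩ := mem_range_of_sliceWeight_pos ha hl
    exact hlt.not_ge (hx.monotone (hi.monotone (h₁ k)))

/-- Of two slices, only one can have its mean strictly between consecutive points. -/
lemma not_lt_of_sliceMean_mem_Ioo (hx : StrictMono x) (hi : StrictMono i) (ha : a ∈ simplexFace i)
    {k k' : Fin n} (hk : (k' : ℕ) = k + 1) {j j' : ℕ} (hj : j < N) (hj' : j' < N)
    (h : sliceMean x N j a ∈ Ioo (x (i k)) (x (i k')))
    (h' : sliceMean x N j' a ∈ Ioo (x (i k)) (x (i k'))) : ¬ j < j' := by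
  intro hlt
  obtain ⟨l, hl, hxl⟩ := exists_lt_of_lt_sliceMean hj ha.1 h.1
  obtain ⟨l', hl', hxl'⟩ := exists_gt_of_sliceMean_lt hj' ha.1 h'.2
  obtain ⟨m, rfl⟩ := mem_range_of_sliceWeight_pos ha hl
  have hkm : k < m := hi.lt_iff_lt.1 (hx.lt_iff_lt.1 hxl)
  have hkm' : k' ≤ m := by
    rw [Fin.le_def, hk]
    exact hkm
  have hl'm : (l' : ℕ) + 1 ≤ i m := (hx.lt_iff_lt.1 hxl').trans_le (hi.monotone hkm')
  have h1 := cumulative_lt_of_sliceWeight_pos hl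
  have h2 := lt_cumulative_of_sliceWeight_pos hl'
  have h3 : (N : ℝ) * cumulative a (l' + 1) ≤ N * cumulative a (i m) :=
    mul_le_mul_of_nonneg_left (cumulative_mono ha.1.1 hl'm) (Nat.cast_nonneg N)
  have h4 : (j : ℝ) + 1 ≤ j' := by exact_mod_cast hlt
  linarith

lemma convexHull_range_comp_subset {E : Type*} [AddCommGroup E] [Module ℝ E] (v : Fin R → E) :
    convexHull ℝ (Set.range (v ∘ i)) ⊆ Fintype.linearCombination ℝ v '' simplexFace i := by
  refine convexHull_min ?_ (Convex.linear_image ?_ _)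
  · rintro _ ⟨k, rfl⟩
    refine ⟨Pi.single (i k) 1, ⟨single_mem_stdSimplex ℝ (i k), fun l hl => ?_⟩, ?_⟩
    · exact Pi.single_eq_of_ne (fun h => hl ⟨k, h.symm⟩) _
    · simp [Fintype.linearCombination_apply_single]
  · intro a ha b hb s t hs ht hst
    refine ⟨convex_stdSimplex ℝ (Fin R) ha.1 hb.1 hs ht hst, fun l hl => ?_⟩
    simp [ha.2 l hl, hb.2 l hl]

end simplexFace

/-- `i` lists the indices of points on a supporting hyperplane of the family `v`. -/
def IsSupported {n R : ℕ} (v : Fin R → Fin n → ℝ) (i : Fin n → Fin R) : Prop :=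
  StrictMono i ∧ ∃ u : Fin n → ℝ, u ≠ 0 ∧ ∃ b : ℝ, (∀ l, u ⬝ᵥ v l ≤ b) ∧ ∀ k, u ⬝ᵥ v (i k) = b

section GeneralPosition

variable {n R : ℕ} {v : Fin R → Fin n → ℝ}

/-- Through any `n` points of `ℝⁿ` there passes an affine hyperplane. -/
lemma exists_dotProduct_eq (hn : 1 ≤ n) (w : Fin n → Fin n → ℝ) :
    ∃ u : Fin n → ℝ, u ≠ 0 ∧ ∃ b : ℝ, ∀ k, u ⬝ᵥ w k = b := by
  let L : (Fin n → ℝ) × ℝ →ₗ[ℝ] (Fin n → ℝ) :=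
    { toFun := fun q k => q.1 ⬝ᵥ w k - q.2
      map_add' := fun q q' => by
        ext k
        simp only [Prod.fst_add, Prod.snd_add, add_dotProduct, Pi.add_apply]
        ring
      map_smul' := fun c q => by
        ext k
        simp only [Prod.smul_fst, Prod.smul_snd, smul_dotProduct, Pi.smul_apply, smul_eq_mul,
          RingHom.id_apply]
        ring }
  have hL : LinearMap.ker L ≠ ⊥ := LinearMap.ker_ne_bot_of_finrank_lt (by simp)
  obtain ⟨⟨u, b⟩, hq, hne⟩ := (Submodule.ne_bot_iff _).1 hL
  have hub : ∀ k, u ⬝ᵥ w k = b := fun k => sub_eq_zero.1 (congrFun hq k)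
  refine ⟨u, ?_, b, hub⟩
  rintro rfl
  have hb := hub ⟨0, hn⟩
  rw [zero_dotProduct] at hb
  exact hne (by rw [← hb]; rfl)

lemma dotProduct_linearCombination (u : Fin n → ℝ) (a : Fin R → ℝ) :
    u ⬝ᵥ Fintype.linearCombination ℝ v a = ∑ l, a l * (u ⬝ᵥ v l) := by
  simp [Fintype.linearCombination_apply, dotProduct_sum]

lemma mem_range_of_dotProduct_eq
    (hgen : ∀ u : Fin n → ℝ, u ≠ 0 → ∀ b : ℝ, {j : Fin R | u ⬝ᵥ v j = b}.ncard ≤ n)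
    {i : Fin n → Fin R} (hi : Function.Injective i) {u : Fin n → ℝ}
    (hu : u ≠ 0) {b : ℝ} (hub : ∀ k, u ⬝ᵥ v (i k) = b) {l : Fin R} (hl : u ⬝ᵥ v l = b) :
    l ∈ Set.range i := by
  have hsub : Set.range i ⊆ {j : Fin R | u ⬝ᵥ v j = b} := by
    rintro _ ⟨k, rfl⟩
    exact hub k
  have hcard : (Set.range i).ncard = n := by
    rw [← Set.image_univ, Set.ncard_image_of_injective _ hi]
    simp
  rw [Set.eq_of_subset_of_ncard_le hsub (by rw [hcard]; exact hgen u hu b) (Set.toFinite _)]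
  exact hl

/-- Points indexed by an injective family are affinely independent, in general position. -/
lemma eq_zero_of_linearCombination_eq_zero
    (hgen : ∀ u : Fin n → ℝ, u ≠ 0 → ∀ b : ℝ, {j : Fin R | u ⬝ᵥ v j = b}.ncard ≤ n)
    (hn : 1 ≤ n) (hR : n < R) {i : Fin n → Fin R}
    (hi : Function.Injective i) {d : Fin R → ℝ} (hd : ∀ l, l ∉ Set.range i → d l = 0)
    (hsum : ∑ l, d l = 0) (hcomb : Fintype.linearCombination ℝ v d = 0) : d = 0 := by
  by_contra hne
  obtain ⟨l₀, hl₀⟩ := Function.ne_iff.1 hne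
  obtain ⟨k₀, rfl⟩ : l₀ ∈ Set.range i := by
    by_contra h
    exact hl₀ (hd _ h)
  obtain ⟨m, hm⟩ : ∃ m, m ∉ Set.range i := by
    by_contra! h
    have := Fintype.card_le_of_surjective i h
    simp only [Fintype.card_fin] at this
    omega
  obtain ⟨u, hu, b, hub⟩ := exists_dotProduct_eq hn (v ∘ Function.update i k₀ m)
  have hne' : ∀ k, k ≠ k₀ → u ⬝ᵥ v (i k) = b := fun k hk => by
    simpa [Function.update_of_ne hk] using hub k
  have hmb : u ⬝ᵥ v m = b := by simpa using hub k₀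
  have hzero : ∑ l, d l * (u ⬝ᵥ v l - b) = 0 := by
    simp only [mul_sub, Finset.sum_sub_distrib, ← Finset.sum_mul, hsum,
      ← dotProduct_linearCombination, hcomb]
    simp
  rw [Finset.sum_eq_single (i k₀)] at hzero
  · have hk₀ : u ⬝ᵥ v (i k₀) = b := by
      have := (mul_eq_zero.1 hzero).resolve_left hl₀
      linarith
    refine hm (mem_range_of_dotProduct_eq hgen hi hu (fun k => ?_) hmb)
    rcases eq_or_ne k k₀ with rfl | hk
    · exact hk₀
    · exact hne' k hk
  · intro l _ hl
    by_cases hr : l ∈ Set.range i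
    · obtain ⟨k, rfl⟩ := hr
      rw [hne' k (fun h => hl (by rw [h])), sub_self, mul_zero]
    · rw [hd l hr, zero_mul]
  · simp

/-- Barycentric coordinates of a point on a supporting hyperplane are unique. -/
lemma eq_of_linearCombination_eq
    (hgen : ∀ u : Fin n → ℝ, u ≠ 0 → ∀ b : ℝ, {j : Fin R | u ⬝ᵥ v j = b}.ncard ≤ n)
    (hn : 1 ≤ n) (hR : n < R) {i : Fin n → Fin R}
    (hi : IsSupported v i) {a a' : Fin R → ℝ} (ha : a ∈ simplexFace i)
    (ha' : a' ∈ stdSimplex ℝ (Fin R))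
    (h : Fintype.linearCombination ℝ v a = Fintype.linearCombination ℝ v a') : a = a' := by
  obtain ⟨hmono, u, hu, b, hle, hub⟩ := hi
  have hsum : ∑ l, a' l * (b - u ⬝ᵥ v l) = 0 := by
    have h1 : ∑ l, a l * (u ⬝ᵥ v l) = b := by
      have : ∀ l, a l * (u ⬝ᵥ v l) = a l * b := fun l => by
        by_cases hl : l ∈ Set.range i
        · obtain ⟨k, rfl⟩ := hl
          rw [hub]
        · rw [ha.2 l hl, zero_mul, zero_mul]
      rw [Finset.sum_congr rfl fun l _ => this l, ← Finset.sum_mul, ha.1.2, one_mul]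
    rw [← dotProduct_linearCombination, h, dotProduct_linearCombination] at h1
    simp only [mul_sub, Finset.sum_sub_distrib, ← Finset.sum_mul, ha'.2, h1]
    ring
  rw [Finset.sum_eq_zero_iff_of_nonneg
    fun l _ => mul_nonneg (ha'.1 l) (sub_nonneg.2 (hle l))] at hsum
  have hd : a - a' = 0 := by
    refine eq_zero_of_linearCombination_eq_zero hgen hn hR hmono.injective (fun l hl => ?_) ?_ ?_
    · have h0 : a' l = 0 := by
        refine (mul_eq_zero.1 (hsum l (Finset.mem_univ l))).resolve_right fun h0 => hl ?_
        exact mem_range_of_dotProduct_eq hgen hmono.injective hu hub (by linarith)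
      simp [ha.2 l hl, h0]
    · simp [Finset.sum_sub_distrib, ha.1.2, ha'.2]
    · rw [map_sub, h, sub_self]
  exact sub_eq_zero.1 hd

/-- A continuous function of the barycentric coordinates of boundary points extends to `ℝⁿ`. -/
lemma exists_continuous_extension
    (hgen : ∀ u : Fin n → ℝ, u ≠ 0 → ∀ b : ℝ, {j : Fin R | u ⬝ᵥ v j = b}.ncard ≤ n)
    (hn : 1 ≤ n) (hR : n < R) {F : (Fin R → ℝ) → ℝ}
    (hF : Continuous F) {t : Set ℝ} [t.OrdConnected] (ht : t.Nonempty)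
    (hFt : ∀ a ∈ stdSimplex ℝ (Fin R), F a ∈ t) :
    ∃ g : (Fin n → ℝ) → ℝ, Continuous g ∧ (∀ p, g p ∈ t) ∧
      ∀ i, IsSupported v i → ∀ a ∈ simplexFace i,
        g (Fintype.linearCombination ℝ v a) = F a := by
  let K : Set (Fin R → ℝ) := ⋃ i ∈ {i | IsSupported v i}, simplexFace i
  have hK : IsCompact K := (Set.toFinite _).isCompact_biUnion fun i _ => isCompact_simplexFace i
  have hmem : ∀ a ∈ K, ∃ i, IsSupported v i ∧ a ∈ simplexFace i := fun a ha => by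
    simpa [K] using ha
  have : CompactSpace K := isCompact_iff_compactSpace.1 hK
  let e : K → Fin n → ℝ := fun a => Fintype.linearCombination ℝ v a
  have he : Topology.IsClosedEmbedding e := by
    refine Continuous.isClosedEmbedding ?_ ?_
    · exact (LinearMap.continuous_of_finiteDimensional _).comp continuous_subtype_val
    · intro a a' h
      obtain ⟨i, hi, ha⟩ := hmem a a.2
      obtain ⟨i', -, ha'⟩ := hmem a' a'.2
      exact Subtype.ext (eq_of_linearCombination_eq hgen hn hR hi ha ha'.1 h)
  obtain ⟨g, hg, hge⟩ := ContinuousMap.exists_extension_forall_mem_of_isClosedEmbedding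
    (⟨fun a : K => F a, hF.comp continuous_subtype_val⟩ : C(K, ℝ))
    (fun a => by
      obtain ⟨i, -, ha⟩ := hmem a a.2
      exact hFt a ha.1) ht he
  refine ⟨g, g.continuous, hg, fun i hi a ha => ?_⟩
  exact congrFun hge ⟨a, Set.mem_biUnion (show i ∈ {i | IsSupported v i} from hi) ha⟩

end GeneralPosition

theorem kane_geometry_lemma (n R N : ℕ) (hn : 1 ≤ n) (hN : 1 ≤ N)
    (v : Fin R → (Fin n → ℝ))
    (hgen : ∀ u : Fin n → ℝ, u ≠ 0 → ∀ b : ℝ, {j : Fin R | u ⬝ᵥ v j = b}.ncard ≤ n)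
    (x : Fin R → ℝ) (hx : StrictMono x) (hxI : ∀ j, x j ∈ Ico (-π) π) :
    ∃ f : Fin N → (Fin n → ℝ) → ℝ,
      (∀ j, ContinuousOn (f j) (convexHull ℝ (Set.range v))) ∧
      (∀ j, ∀ p ∈ convexHull ℝ (Set.range v), f j p ∈ Ico (-π) π) ∧
      ∀ u : Fin n → ℝ, u ≠ 0 → ∀ b : ℝ,
        (∀ w ∈ convexHull ℝ (Set.range v), u ⬝ᵥ w ≤ b) →
        ∀ i : Fin n → Fin R, StrictMono i → (∀ k, u ⬝ᵥ v (i k) = b) →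
        ∀ p ∈ convexHull ℝ (Set.range (v ∘ i)),
          (∀ j, f j p ∈ Icc (x (i ⟨0, hn⟩)) (x (i ⟨n - 1, Nat.sub_lt hn one_pos⟩))) ∧
          ∀ k : ℕ, ∀ hk : k + 1 < n,
            {j : Fin N |
              f j p ∈ Ioo (x (i ⟨k, Nat.lt_of_succ_lt hk⟩)) (x (i ⟨k + 1, hk⟩))}.Subsingleton := by
  rcases lt_or_ge n R with hR | hR
  · have hne : (Ico (-π) π).Nonempty := ⟨_, hxI ⟨0, by omega⟩⟩
    choose f hfc hft hf using fun j : Fin N => exists_continuous_extension hgen hn hR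
      (continuous_sliceMean x N j) hne
      fun a ha => sliceMean_mem (convex_Ico _ _) j.2 ha hxI
    refine ⟨f, fun j => (hfc j).continuousOn, fun j p _ => hft j p, ?_⟩
    intro u hu b hle i hi hub p hp
    have hsupp : IsSupported v i :=
      ⟨hi, u, hu, b, fun l => hle _ (subset_convexHull ℝ _ ⟨l, rfl⟩), hub⟩
    obtain ⟨a, ha, rfl⟩ := convexHull_range_comp_subset v hp
    simp only [hf _ i hsupp a ha]
    refine ⟨fun j => sliceMean_mem_Icc hx hi j.2 ha (fun k => ?_) (fun k => ?_), ?_⟩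
    · simp [Fin.le_def]
    · have := k.2
      simp only [Fin.le_def]
      omega
    · intro k hk j hj j' hj'
      rcases lt_trichotomy j j' with h | h | h
      · exact absurd h (not_lt_of_sliceMean_mem_Ioo hx hi ha rfl j.2 j'.2 hj hj')
      · exact h
      · exact absurd h (not_lt_of_sliceMean_mem_Ioo hx hi ha rfl j'.2 j.2 hj' hj)
  · rcases Nat.eq_zero_or_pos R with rfl | hR0
    · refine ⟨fun _ _ => 0, fun _ => continuousOn_const, fun _ _ _ => ?_, ?_⟩
      · exact ⟨neg_nonpos.2 pi_pos.le, pi_pos⟩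
      · intro _ _ _ _ i
        exact (i ⟨0, hn⟩).elim0
    · refine ⟨fun _ _ => x ⟨0, hR0⟩, fun _ => continuousOn_const, fun _ _ _ => hxI _, ?_⟩
      intro u hu b hle i hi hub p hp
      have hmin : ∀ l, x ⟨0, hR0⟩ ≤ x l := fun l => hx.monotone (by simp [Fin.le_def])
      have hsurj : Function.Surjective i :=
        (hi.injective.bijective_of_nat_card_le (by simpa using hR)).2
      obtain ⟨k₀, hk₀⟩ := hsurj ⟨0, hR0⟩
      refine ⟨fun _ => ⟨?_, hmin _⟩, fun k hk j hj => ?_⟩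
      · rw [← hk₀]
        exact hx.monotone (hi.monotone (by simp [Fin.le_def]))
      · exact absurd hj.1 (hmin _).not_gt
end
end

section
/- Let Q ⊂ ℝ^n be the convex hull of a finite set of points, with 0 in the interior of Q. Let F : Q → ℝ^n be a continuous function such that for every u ∈ ℝ^n with u·w ≤ 1 for all w ∈ Q, and every v ∈ Q with u·v = 1, one has u·F(v) > 0. Then there exists v ∈ Q such that F(v) = 0. -/
open Real Set Matrix
noncomputable section

open MeasureTheory Metric Topology Module
open scoped NNReal RealInnerProductSpace

section Retraction

variable {E : Type*} [NormedAddCommGroup E] [InnerProductSpace ℝ E]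

theorem exists_polynomial_eval_eq_det_one_add_smul [FiniteDimensional ℝ E] (A : E →L[ℝ] E) :
    ∃ p : Polynomial ℝ, p.natDegree ≤ finrank ℝ E ∧
      ∀ t : ℝ, p.eval t = (1 + t • A).det := by
  classical
  let b := finBasis ℝ E
  let M := LinearMap.toMatrix b b (A : E →ₗ[ℝ] E)
  refine ⟨((Polynomial.X : Polynomial ℝ) • M.map Polynomial.C +
      (1 : Matrix _ _ ℝ).map Polynomial.C).det, ?_, fun t => ?_⟩
  · simpa using Polynomial.natDegree_det_X_add_C_le M 1
  · have h : (1 + t • A).det = (1 + t • M).det := by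
      change LinearMap.det ((1 + t • A : E →L[ℝ] E) : E →ₗ[ℝ] E) = _
      rw [← LinearMap.det_toMatrix b]
      congr 1
      simp [M, LinearMap.toMatrix_one, ContinuousLinearMap.toLinearMap_add]
    rw [h, ← Polynomial.coe_evalRingHom, RingHom.map_det]
    congr 1
    ext i j
    by_cases hij : i = j <;> simp [hij] <;> ring

theorem exists_eval_one_eq_sum {m : ℕ} {t : Fin (m + 1) → ℝ} (ht : Function.Injective t) :
    ∃ c : Fin (m + 1) → ℝ, ∀ p : Polynomial ℝ, p.natDegree ≤ m →
      p.eval 1 = ∑ i, c i * p.eval (t i) := by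
  refine ⟨fun i => (Lagrange.basis Finset.univ t i).eval 1, fun p hp => ?_⟩
  have hlt : p.degree < (Finset.univ : Finset (Fin (m + 1))).card := by
    rw [Finset.card_univ, Fintype.card_fin]
    exact (Polynomial.degree_le_of_natDegree_le hp).trans_lt (by exact_mod_cast Nat.lt_succ_self m)
  conv_lhs => rw [Lagrange.eq_interpolate (s := Finset.univ) (v := t) ht.injOn hlt]
  simp [Lagrange.interpolate_apply, Polynomial.eval_finsetSum, mul_comm]

/-- A Lipschitz map on a closed ball vanishing on the sphere stays Lipschitz when extended by zero. -/
theorem LipschitzOnWith.indicator_closedBall {g : E → E} {R : ℝ} {K : ℝ≥0}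
    (hg : LipschitzOnWith K g (closedBall 0 R)) (h0 : ∀ x, ‖x‖ = R → g x = 0) :
    LipschitzWith K ((closedBall (0 : E) R).indicator g) := by
  have key : ∀ x ∈ closedBall (0 : E) R, ∀ y ∉ closedBall (0 : E) R,
      ‖g x‖ ≤ K * dist x y := by
    intro x hx y hy
    rw [mem_closedBall_zero_iff] at hx hy
    obtain ⟨z, hz, hzR⟩ : ∃ z ∈ segment ℝ x y, ‖z‖ = R :=
      (convex_segment x y).isPreconnected.intermediate_value (left_mem_segment ℝ x y)
        (right_mem_segment ℝ x y) continuous_norm.continuousOn ⟨hx, (not_le.1 hy).le⟩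
    calc ‖g x‖ = dist (g x) (g z) := by rw [h0 z hzR, dist_zero_right]
      _ ≤ K * dist x z := hg.dist_le_mul x (by simpa using hx) z (by simp [hzR])
      _ ≤ K * dist x y := by
        gcongr
        linarith [dist_add_dist_of_mem_segment hz, dist_nonneg (x := z) (y := y)]
  refine LipschitzWith.of_dist_le_mul fun x y => ?_
  by_cases hx : x ∈ closedBall (0 : E) R <;> by_cases hy : y ∈ closedBall (0 : E) R
  · simpa [indicator_of_mem hx, indicator_of_mem hy] using hg.dist_le_mul x hx y hy
  · simpa [indicator_of_mem hx, indicator_of_notMem hy] using key x hx y hy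
  · simpa [indicator_of_notMem hx, indicator_of_mem hy, dist_comm x y] using key y hy x hx
  · simp only [indicator_of_notMem hx, indicator_of_notMem hy, dist_self]
    positivity

theorem bijOn_closedBall_id_add_smul [CompleteSpace E] {g : E → E} {R t : ℝ} {K : ℝ≥0}
    (hg : LipschitzOnWith K g (closedBall 0 R)) (h0 : ∀ x, ‖x‖ = R → g x = 0)
    (hmap : MapsTo (fun x => x + g x) (closedBall 0 R) (closedBall 0 R))
    (ht : 0 ≤ t) (ht1 : t ≤ 1) (htK : t * K < 1) :
    BijOn (fun x => x + t • g x) (closedBall 0 R) (closedBall 0 R) := by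
  refine ⟨fun x hx => ?_, fun x hx y hy hxy => ?_, fun y hy => ?_⟩
  · have := convex_closedBall (0 : E) R hx (hmap hx) (sub_nonneg.2 ht1) ht (by ring)
    convert this using 1
    module
  · have h1 : x - y = t • (g y - g x) := by
      have : x + t • g x = y + t • g y := hxy
      rw [smul_sub, sub_eq_sub_iff_add_eq_add, this, add_comm]
    have h2 : dist x y ≤ t * K * dist x y := by
      calc dist x y = t * dist (g y) (g x) := by
            rw [dist_eq_norm, h1, norm_smul, Real.norm_of_nonneg ht, dist_eq_norm]
        _ ≤ t * (K * dist y x) := by gcongr; exact hg.dist_le_mul y hy x hx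
        _ = t * K * dist x y := by rw [dist_comm]; ring
    refine dist_le_zero.1 ?_
    nlinarith [dist_nonneg (x := x) (y := y)]
  · have hh := hg.indicator_closedBall h0
    set h := (closedBall (0 : E) R).indicator g with hdef
    have hc : ContractingWith (t.toNNReal * K) (fun x => y - t • h x) := by
      refine ⟨?_, LipschitzWith.of_dist_le_mul fun a b => ?_⟩
      · rw [← NNReal.coe_lt_coe]
        simpa [Real.coe_toNNReal t ht] using htK
      · rw [dist_sub_left, dist_smul₀, Real.norm_of_nonneg ht]
        have := mul_le_mul_of_nonneg_left (hh.dist_le_mul a b) ht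
        simpa [Real.coe_toNNReal t ht, mul_assoc] using this
    have hx : y - t • h (hc.fixedPoint _) = hc.fixedPoint _ := hc.fixedPoint_isFixedPt
    set x := hc.fixedPoint _
    have hxB : x ∈ closedBall (0 : E) R := by
      by_contra hxB
      rw [hdef, indicator_of_notMem hxB, smul_zero, sub_zero] at hx
      exact hxB (hx ▸ hy)
    rw [hdef, indicator_of_mem hxB] at hx
    exact ⟨x, hxB, by simp only; rw [← sub_eq_iff_eq_add.1 hx]⟩

theorem integral_det_fderiv_closedBall [FiniteDimensional ℝ E] [MeasurableSpace E] [BorelSpace E]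
    (μ : Measure E) [μ.IsAddHaarMeasure] {r : E → E} {R : ℝ} (hr : ContDiff ℝ 1 r)
    (hmap : MapsTo r (closedBall 0 R) (closedBall 0 R)) (hfix : ∀ x, ‖x‖ = R → r x = x) :
    ∫ x in closedBall 0 R, (fderiv ℝ r x).det ∂μ = μ.real (closedBall 0 R) := by
  have hB : IsCompact (closedBall (0 : E) R) := isCompact_closedBall 0 R
  set g : E → E := fun x => r x - x with hgdef
  have hg : ContDiff ℝ 1 g := hr.sub contDiff_id
  have hgd : ∀ x, HasFDerivAt g (fderiv ℝ g x) x := fun x =>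
    (hg.differentiable one_ne_zero x).hasFDerivAt
  have hg' : Continuous (fderiv ℝ g) := hg.continuous_fderiv one_ne_zero
  obtain ⟨K, hK⟩ : ∃ K, LipschitzOnWith K g (closedBall 0 R) :=
    hg.contDiffOn.exists_lipschitzOnWith one_ne_zero (convex_closedBall 0 R) hB
  have hdet : Continuous fun z : ℝ × E => (1 + z.1 • fderiv ℝ g z.2).det :=
    ContinuousLinearMap.continuous_det.comp (by fun_prop)
  have hpos : ∀ᶠ t in 𝓝 (0 : ℝ), ∀ x ∈ closedBall (0 : E) R, 0 < (1 + t • fderiv ℝ g x).det := by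
    refine hB.eventually_forall_of_forall_eventually fun x _ => ?_
    refine hdet.continuousAt.eventually (lt_mem_nhds ?_)
    simp [ContinuousLinearMap.det]
  have hsmall : ∀ᶠ t : ℝ in 𝓝 0, t * K < 1 ∧ t ≤ 1 := by
    have : Filter.Tendsto (fun t : ℝ => t * (K : ℝ)) (𝓝 0) (𝓝 (0 : ℝ)) :=
      (continuous_id.mul continuous_const).tendsto' _ _ (by simp)
    exact (this.eventually_lt_const one_pos).and (ge_mem_nhds one_pos)
  obtain ⟨δ, hδ, hball⟩ := Metric.eventually_nhds_iff.1 (hpos.and hsmall)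
  have hvol : ∀ t, 0 < t → t < δ →
      ∫ x in closedBall 0 R, (1 + t • fderiv ℝ g x).det ∂μ = μ.real (closedBall 0 R) := by
    intro t ht htδ
    obtain ⟨hp, htK, ht1⟩ := hball (y := t) (by rwa [Real.dist_0_eq_abs, abs_of_pos ht])
    have hbij := bijOn_closedBall_id_add_smul hK (fun x hx => sub_eq_zero.2 (hfix x hx))
      (by simpa [hgdef] using hmap) ht.le ht1 htK
    have hcv := integral_image_eq_integral_abs_det_fderiv_smul μ measurableSet_closedBall
      (f := fun x => x + t • g x) (f' := fun x => 1 + t • fderiv ℝ g x)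
      (fun x _ => ((hasFDerivAt_id x).add ((hgd x).const_smul t)).hasFDerivWithinAt)
      hbij.injOn (fun _ => (1 : ℝ))
    rw [hbij.image_eq] at hcv
    rw [← setIntegral_one_eq_measureReal, hcv]
    refine setIntegral_congr_fun measurableSet_closedBall fun x hx => ?_
    simp [abs_of_pos (hp x hx)]
  let t : Fin (finrank ℝ E + 1) → ℝ := fun i => δ / (i + 2)
  have htinj : Function.Injective t := fun i j hij => by
    have h1 : (i : ℝ) + 2 ≠ 0 := by positivity
    have h2 : (j : ℝ) + 2 ≠ 0 := by positivity
    have : (i : ℝ) = j := by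
      simp only [t] at hij
      field_simp at hij
      linarith
    exact Fin.ext (by exact_mod_cast this)
  obtain ⟨c, hc⟩ := exists_eval_one_eq_sum htinj
  have hsum : ∑ i, c i = 1 := by simpa using (hc 1 (by simp)).symm
  have hpt : ∀ x, (fderiv ℝ r x).det = ∑ i, c i * (1 + t i • fderiv ℝ g x).det := by
    intro x
    obtain ⟨p, hp, hpe⟩ := exists_polynomial_eval_eq_det_one_add_smul (fderiv ℝ g x)
    have hrg : fderiv ℝ r x = 1 + (1 : ℝ) • fderiv ℝ g x := by
      rw [hgdef, fderiv_fun_sub (hr.differentiable one_ne_zero x) differentiableAt_fun_id, one_smul]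
      simp [ContinuousLinearMap.one_def]
    rw [hrg, ← hpe, hc p hp]
    simp only [hpe]
  simp_rw [hpt]
  rw [integral_finsetSum]
  · simp_rw [integral_const_mul]
    rw [Finset.sum_congr rfl fun i _ => by
      rw [hvol (t i) (by positivity) (div_lt_self hδ (by linarith [(Nat.cast_nonneg i.1 : (0:ℝ) ≤ i.1)]))],
      ← Finset.sum_mul, hsum, one_mul]
  · intro i _
    exact ((hdet.comp (by fun_prop : Continuous fun x : E => (t i, x))).continuousOn.integrableOn_compact
      hB).const_mul _

theorem exists_norm_ne_of_contDiff_of_eq_on_sphere [FiniteDimensional ℝ E] {r : E → E} {R : ℝ}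
    (hR : 0 < R) (hr : ContDiff ℝ 1 r) (hfix : ∀ x, ‖x‖ = R → r x = x) : ∃ x, ‖r x‖ ≠ R := by
  by_contra! hnorm
  borelize E
  have hdet : ∀ x, (fderiv ℝ r x).det = 0 := by
    intro x
    by_contra hne
    have horth : ∀ v, ⟪r x, fderiv ℝ r x v⟫ = 0 := by
      intro v
      have hd := (hr.differentiable one_ne_zero x).hasFDerivAt
      have h1 := hd.norm_sq
      have h2 : HasFDerivAt (fun y => ‖r y‖ ^ 2) (0 : E →L[ℝ] ℝ) x := by
        simpa only [hnorm] using hasFDerivAt_const (R ^ 2) x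
      simpa using DFunLike.congr_fun (h1.unique h2) v
    have hsurj := (LinearMap.equivOfDetNeZero _ hne).surjective
    obtain ⟨v, hv⟩ := hsurj (r x)
    have hv : fderiv ℝ r x v = r x := hv
    have := horth v
    rw [hv, inner_self_eq_zero] at this
    have h3 := hnorm x
    rw [this, norm_zero] at h3
    exact hR.ne h3
  have h := integral_det_fderiv_closedBall (volume : Measure E) (R := R) hr
    (fun x _ => by simp [hnorm x]) hfix
  simp only [hdet, integral_zero] at h
  have := measure_closedBall_pos (volume : Measure E) 0 hR
  exact (ENNReal.toReal_pos this.ne' measure_closedBall_lt_top.ne).ne h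

/-- A continuous self-map of a Euclidean space that is the identity near infinity has a zero. -/
theorem exists_eq_zero_of_continuous_of_eq_id [FiniteDimensional ℝ E] {H : E → E} {R : ℝ}
    (hR : 0 < R) (hH : Continuous H) (hid : ∀ x, R ≤ ‖x‖ → H x = x) : ∃ x, H x = 0 := by
  by_contra! hne
  have hU : IsOpen {x : E | R < ‖x‖} := isOpen_lt continuous_const continuous_norm
  obtain ⟨G, hG, hclose, heq, -⟩ := hH.exists_contDiff_approx_and_eqOn 1
    (ε := fun x => ‖H x‖) hH.norm (fun x => norm_pos_iff.2 (hne x))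
    (S := {x : E | R + 1 ≤ ‖x‖}) (U := {x | R < ‖x‖})
    (isClosed_le continuous_const continuous_norm)
    (hU.mem_nhdsSet.2 fun x (hx : R + 1 ≤ ‖x‖) => show R < ‖x‖ by linarith)
    (contDiff_id.contDiffOn.congr fun x (hx : R < ‖x‖) => hid x hx.le)
  have hG0 : ∀ x, G x ≠ 0 := fun x h0 => by simpa [h0] using hclose x
  obtain ⟨x, hx⟩ := exists_norm_ne_of_contDiff_of_eq_on_sphere
    (r := fun x => ((R + 1) / ‖G x‖) • G x) (R := R + 1) (by linarith)
    ((contDiff_const.div (hG.norm ℝ hG0) fun x => norm_ne_zero_iff.2 (hG0 x)).smul hG)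
    (fun x hx => by
      have : G x = x := (heq (show R + 1 ≤ ‖x‖ from hx.ge)).trans (hid x (by linarith))
      simp only [this, hx]
      rw [div_self (by linarith), one_smul])
  apply hx
  rw [norm_smul, norm_div, norm_norm, div_mul_cancel₀ _ (norm_ne_zero_iff.2 (hG0 x)),
    Real.norm_of_nonneg (by linarith)]

/-- Brouwer's theorem for maps with bounded range. -/
theorem exists_eq_self_of_continuous_of_norm_lt [FiniteDimensional ℝ E] {T : E → E} {R : ℝ}
    (hT : Continuous T) (hTR : ∀ x, ‖T x‖ < R) : ∃ x, T x = x := by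
  have hR : 0 < R := (norm_nonneg _).trans_lt (hTR 0)
  let χ : E → ℝ := fun x => max 0 (min 1 (2 - ‖x‖ / R))
  have hχ : Continuous χ := by fun_prop
  obtain ⟨x, hx⟩ := exists_eq_zero_of_continuous_of_eq_id (H := fun x => x - χ x • T x) (R := 2 * R)
    (by linarith) (by fun_prop) (fun x hx => by
      have : 2 ≤ ‖x‖ / R := (le_div_iff₀ hR).2 hx
      have : χ x = 0 := max_eq_left ((min_le_right _ _).trans (by linarith))
      simp [this])
  have hx : x = χ x • T x := sub_eq_zero.1 hx
  have h0 : 0 ≤ χ x := le_max_left _ _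
  have h1 : χ x ≤ 1 := max_le zero_le_one (min_le_left _ _)
  have hxR : ‖x‖ ≤ R := by
    rw [hx, norm_smul, Real.norm_of_nonneg h0]
    nlinarith [hTR x, norm_nonneg (T x)]
  have hχx : χ x = 1 := by
    have : ‖x‖ / R ≤ 1 := (div_le_one hR).2 hxR
    simp only [χ]
    rw [min_eq_left (by linarith), max_eq_right zero_le_one]
  refine ⟨x, ?_⟩
  rw [hχx, one_smul] at hx
  exact hx.symm

/-- Metric projection onto a closed convex set. -/
theorem exists_continuous_projection [CompleteSpace E] {K : Set E} (hne : K.Nonempty)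
    (hK : IsClosed K) (hconv : Convex ℝ K) :
    ∃ P : E → E, Continuous P ∧ (∀ x, P x ∈ K) ∧ ∀ x, ∀ w ∈ K, ⟪x - P x, w - P x⟫ ≤ 0 := by
  choose P hPK hP using exists_norm_eq_iInf_of_complete_convex hne hK.isComplete hconv
  have hvar : ∀ x, ∀ w ∈ K, ⟪x - P x, w - P x⟫ ≤ 0 := fun x =>
    (norm_eq_iInf_iff_real_inner_le_zero hconv (hPK x)).1 (hP x)
  refine ⟨P, ?_, hPK, hvar⟩
  refine LipschitzWith.continuous (K := 1) (LipschitzWith.of_dist_le_mul fun x y => ?_)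
  have h1 := hvar x (P y) (hPK y)
  have h2 := hvar y (P x) (hPK x)
  have h3 : ‖P x - P y‖ ^ 2 ≤ ⟪x - y, P x - P y⟫ := by
    rw [← real_inner_self_eq_norm_sq]
    simp only [inner_sub_left, inner_sub_right] at h1 h2 ⊢
    linarith
  have h4 := real_inner_le_norm (x - y) (P x - P y)
  rw [NNReal.coe_one, one_mul, dist_eq_norm, dist_eq_norm]
  nlinarith [norm_nonneg (P x - P y), norm_nonneg (x - y)]

/-- The Hartman–Stampacchia variational inequality. -/
theorem exists_forall_inner_sub_nonneg [FiniteDimensional ℝ E] {K : Set E} (hne : K.Nonempty)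
    (hK : IsCompact K) (hconv : Convex ℝ K) {F : E → E} (hF : ContinuousOn F K) :
    ∃ v ∈ K, ∀ w ∈ K, 0 ≤ ⟪F v, w - v⟫ := by
  obtain ⟨P, hPc, hPK, hP⟩ := exists_continuous_projection hne hK.isClosed hconv
  obtain ⟨R, hR⟩ := hK.isBounded.exists_norm_le
  obtain ⟨x, hx⟩ := exists_eq_self_of_continuous_of_norm_lt (T := fun x => P (P x - F (P x)))
    (R := R + 1) (hPc.comp (hPc.sub (hF.comp_continuous hPc hPK)))
    (fun x => (hR _ (hPK _)).trans_lt (lt_add_one R))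
  refine ⟨P x, hPK x, fun w hw => ?_⟩
  have hxK : x ∈ K := hx ▸ hPK _
  have hPx : P x = x := by
    have := hP x x hxK
    exact (sub_eq_zero.1 (real_inner_self_nonpos.1 this)).symm
  have := hP (P x - F (P x)) w hw
  simp only [hx] at this
  simpa [hPx] using this

end Retraction

theorem kane_topology_lemma (n : ℕ) (s : Finset (Fin n → ℝ))
    (Q : Set (Fin n → ℝ)) (hQ : Q = convexHull ℝ (↑s : Set (Fin n → ℝ)))
    (h0 : (0 : Fin n → ℝ) ∈ interior Q)
    (F : (Fin n → ℝ) → (Fin n → ℝ)) (hF : ContinuousOn F Q)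
    (hface : ∀ u : Fin n → ℝ, (∀ w ∈ Q, u ⬝ᵥ w ≤ 1) →
      ∀ v ∈ Q, u ⬝ᵥ v = 1 → 0 < u ⬝ᵥ F v) :
    ∃ v ∈ Q, F v = 0 := by
  let e := EuclideanSpace.equiv (Fin n) ℝ
  have hQc : IsCompact Q := hQ ▸ s.finite_toSet.isCompact_convexHull ℝ
  have hQconv : Convex ℝ Q := hQ ▸ convex_convexHull ℝ _
  obtain ⟨v, hv, hvar⟩ := exists_forall_inner_sub_nonneg (K := e.symm '' Q)
    (F := fun x => e.symm (F (e x)))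
    ⟨_, mem_image_of_mem _ (interior_subset h0)⟩ (hQc.image e.symm.continuous)
    (hQconv.linear_image e.symm.toLinearMap)
    (e.symm.continuous.comp_continuousOn (hF.comp e.continuous.continuousOn
      (by rintro _ ⟨y, hy, rfl⟩; simpa using hy)))
  obtain ⟨v, hvQ, rfl⟩ := hv
  simp only [e.apply_symm_apply] at hvar
  have hvar' : ∀ w ∈ Q, F v ⬝ᵥ v ≤ F v ⬝ᵥ w := by
    intro w hw
    have := hvar _ (mem_image_of_mem _ hw)
    rw [← map_sub] at this
    have h' : 0 ≤ F v ⬝ᵥ (w - v) := by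
      simpa [e, EuclideanSpace.inner_eq_star_dotProduct, dotProduct_comm] using this
    rw [dotProduct_sub] at h'
    linarith
  refine ⟨v, hvQ, ?_⟩
  by_contra hne
  have hpos : 0 < F v ⬝ᵥ F v := by
    simpa using Matrix.dotProduct_star_self_pos_iff.2 hne
  have hneg : F v ⬝ᵥ v < 0 := by
    have hcont : Filter.Tendsto (fun t : ℝ => -t • F v) (𝓝[>] 0) (𝓝 0) := by
      refine Filter.Tendsto.mono_left ?_ nhdsWithin_le_nhds
      exact (by fun_prop : Continuous fun t : ℝ => -t • F v).tendsto' _ _ (by simp)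
    obtain ⟨t, htQ, ht⟩ := ((hcont.eventually (mem_interior_iff_mem_nhds.1 h0)).and
      self_mem_nhdsWithin).exists
    have := hvar' _ htQ
    rw [dotProduct_smul, smul_eq_mul] at this
    nlinarith [mul_pos (mem_Ioi.1 ht) hpos]
  set c := F v ⬝ᵥ v with hc
  have key := hface (c⁻¹ • F v) (fun w hw => by
    rw [smul_dotProduct, smul_eq_mul, inv_mul_eq_div, div_le_one_of_neg hneg]
    exact hvar' w hw) v hvQ (by
    rw [smul_dotProduct, smul_eq_mul, ← hc, inv_mul_cancel₀ hneg.ne])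
  rw [smul_dotProduct, smul_eq_mul] at key
  nlinarith [mul_neg_of_neg_of_pos (inv_lt_zero.2 hneg) hpos]
end
end
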